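/- Let k ≥ 1, n ≥ 0, and let S_1,…,S_k ⊆ {1,…,n} with |S_i| = k − 1 for every i. Let M be the k×k matrix over K_n whose (i,c) entry is the coefficient of x^{k−c} in the polynomial ∏_{j∈S_i}(x+α_j), i.e., the (c−1)-st elementary symmetric polynomial in the variables {α_j : j ∈ S_i}. Then det M ≠ 0 if and only if for every nonempty Ω ⊆ {1,…,k}: |∩_{i∈Ω} S_i| ≤ k − |Ω|. -/

import Mathlib

open Polynomial

/-- `Kn n` is the field `K_n = ℚ(α_1,…,α_n)` of rational functions in `n`
indeterminates over `ℚ` (for `n = 0` it is just `ℚ` up to isomorphism). -/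
noncomputable abbrev Kn (n : ℕ) : Type := FractionRing (MvPolynomial (Fin n) ℚ)

/-- The indeterminate `α_j` viewed as an element of `K_n`. -/
noncomputable def alf {n : ℕ} (j : Fin n) : Kn n :=
  algebraMap (MvPolynomial (Fin n) ℚ) (Kn n) (MvPolynomial.X j)

/-- The degree-`(k-1)` polynomial `x^(k-|S|-1) * ∏_{j ∈ S} (x + α_j)` whose
coefficients form the rows of a block of the matrix `M`. -/
noncomputable def rowPoly {n : ℕ} (k : ℕ) (S : Finset (Fin n)) : Polynomial (Kn n) :=
  X ^ (k - S.card - 1) * ∏ j ∈ S, (X + C (alf j))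

/-- The row offset of block `i`, namely `r_1 + ⋯ + r_{i-1}`. -/
def off {m : ℕ} (r : Fin m → ℕ) (i : Fin m) : ℕ :=
  ∑ j ∈ Finset.univ.filter (· < i), r j

/-- The `k × k` matrix `M[(S_i,r_i)]_{i=1}^m` over `K_n`: rows are grouped into `m`
blocks, block `i` consisting of the `r i` rows with (0-based) indices
`off r i ≤ ρ < off r i + r i`.  Writing `t = ρ - off r i` (so `0 ≤ t ≤ r i - 1`),
the entry of such a row in (0-based) column `c` is the coefficient of
`x^(k-1-c+t)` in `rowPoly k (S i)` when `t ≤ c`, and `0` when `c < t`.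
(When `∑ i, r i = k` the blocks exactly partition the `k` rows, so for each row
exactly one summand below is active.) -/
noncomputable def gmM {n m : ℕ} (k : ℕ) (S : Fin m → Finset (Fin n)) (r : Fin m → ℕ) :
    Matrix (Fin k) (Fin k) (Kn n) :=
  Matrix.of fun ρ c => ∑ i : Fin m,
    if off r i ≤ (ρ : ℕ) ∧ (ρ : ℕ) < off r i + r i ∧ (ρ : ℕ) - off r i ≤ (c : ℕ)
    then (rowPoly k (S i)).coeff (k - 1 - (c : ℕ) + ((ρ : ℕ) - off r i)) else 0

section SupportConstrained

variable {ι σ : Type*}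

/-- The polynomial `x ^ b * ∏_{j ∈ A} (x + a_j)`. -/
noncomputable def nodePoly {R : Type*} [CommRing R] (a : σ → R) (A : Finset σ) (b : ℕ) : R[X] :=
  X ^ b * ∏ j ∈ A, (X + C (a j))

theorem map_nodePoly {R R' : Type*} [CommRing R] [CommRing R'] (f : R →+* R') (a : σ → R)
    (A : Finset σ) (b : ℕ) :
    (nodePoly a A b).map f = nodePoly (fun j => f (a j)) A b := by
  simp [nodePoly, Polynomial.map_prod]

theorem monic_nodePoly {R : Type*} [CommRing R] (a : σ → R) (A : Finset σ) (b : ℕ) :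
    (nodePoly a A b).Monic :=
  (monic_X_pow b).mul (monic_prod_of_monic _ _ fun j _ => monic_X_add_C (a j))

theorem natDegree_nodePoly {R : Type*} [CommRing R] [Nontrivial R] (a : σ → R)
    (A : Finset σ) (b : ℕ) : (nodePoly a A b).natDegree = b + A.card := by
  rw [nodePoly, (monic_X_pow b).natDegree_mul
    (monic_prod_of_monic _ _ fun j _ => monic_X_add_C (a j)),
    natDegree_prod_of_monic _ _ fun j _ => monic_X_add_C (a j)]
  simp

theorem nodePoly_mul_nodePoly_sdiff [DecidableEq σ]
    {R : Type*} [CommRing R] (a : σ → R) {A B : Finset σ}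
    {b c : ℕ} (hA : A ⊆ B) (hb : b ≤ c) :
    nodePoly a A b * nodePoly a (B \ A) (c - b) = nodePoly a B c := by
  have h1 := Finset.prod_sdiff (f := fun j => (X + C (a j) : R[X])) hA
  rw [nodePoly, nodePoly, nodePoly, ← h1, ← Nat.add_sub_cancel' hb, pow_add,
    Nat.add_sub_cancel_left]
  ring

/-- The polynomials `x ^ e * nodePoly a (A i) (b i)`, for `i ∈ s` and `e < d i`, are linearly
independent. -/
def IndepAt (s : Finset ι) (A : ι → Finset σ) (b d : ι → ℕ) (a : σ → ℚ) : Prop :=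
  ∀ q : ι → ℚ[X], (∀ i ∈ s, (q i).degree < d i) →
    ∑ i ∈ s, q i * nodePoly a (A i) (b i) = 0 → ∀ i ∈ s, q i = 0

/-- Injectivity of a polynomially parametrised linear map is an open condition. -/
theorem exists_eval_ne_zero_imp_injective {V : Type*} [AddCommGroup V] [Module ℚ V]
    [FiniteDimensional ℚ V] (T : (σ → ℚ) → V →ₗ[ℚ] ℚ[X]) (P : V → (MvPolynomial σ ℚ)[X])
    (hP : ∀ a v, (P v).map (MvPolynomial.eval a) = T a v) (a₀ : σ → ℚ)
    (h₀ : Function.Injective (T a₀)) :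
    ∃ D : MvPolynomial σ ℚ, MvPolynomial.eval a₀ D ≠ 0 ∧
      ∀ a, MvPolynomial.eval a D ≠ 0 → Function.Injective (T a) := by
  obtain ⟨L, hL⟩ := LinearMap.exists_leftInverse_of_injective (T a₀) (LinearMap.ker_eq_bot.2 h₀)
  let B := Module.finBasis ℚ V
  let M : Matrix (Fin (Module.finrank ℚ V)) (Fin (Module.finrank ℚ V)) (MvPolynomial σ ℚ) :=
    Matrix.of fun c' c => ∑ r ∈ (P (B c)).support,
      (P (B c)).coeff r * MvPolynomial.C (B.repr (L (X ^ r)) c')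
  have hM : ∀ a, MvPolynomial.eval a M.det = LinearMap.det (L ∘ₗ T a) := by
    intro a
    rw [RingHom.map_det, ← LinearMap.det_toMatrix B]
    congr 1
    ext c' c
    have h1 : T a (B c) = ∑ r ∈ (P (B c)).support,
        (MvPolynomial.eval a ((P (B c)).coeff r)) • (X ^ r : ℚ[X]) := by
      rw [← hP]
      conv_lhs => rw [(P (B c)).as_sum_support, Polynomial.map_sum]
      refine Finset.sum_congr rfl fun r _ => ?_
      rw [map_monomial, smul_X_eq_monomial]
    simp [M, LinearMap.toMatrix_apply, h1]
  refine ⟨M.det, ?_, fun a ha => ?_⟩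
  · rw [hM, hL, LinearMap.det_id]
    exact one_ne_zero
  · rw [hM] at ha
    have h2 := (LinearMap.equivOfDetNeZero _ ha).injective
    exact Function.Injective.of_comp (f := L) h2

theorem IndepAt.exists_eval_ne_zero [DecidableEq ι]
    {s : Finset ι} {A : ι → Finset σ} {b d : ι → ℕ} {a₀ : σ → ℚ} (h : IndepAt s A b d a₀) :
    ∃ D : MvPolynomial σ ℚ, D ≠ 0 ∧ ∀ a, MvPolynomial.eval a D ≠ 0 → IndepAt s A b d a := by
  let V := (i : s) → degreeLT ℚ (d i)
  let T : (σ → ℚ) → V →ₗ[ℚ] ℚ[X] := fun a =>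
    ∑ i : s, (LinearMap.mulRight ℚ (nodePoly a (A i) (b i))) ∘ₗ
      (degreeLT ℚ (d i)).subtype ∘ₗ LinearMap.proj i
  have hT : ∀ a v, T a v = ∑ i : s, (v i : ℚ[X]) * nodePoly a (A i) (b i) := by
    intro a v
    simp only [T, LinearMap.sum_apply]
    rfl
  have : ∀ i : s, FiniteDimensional ℚ (degreeLT ℚ (d i)) := fun i =>
    (degreeLTEquiv ℚ (d i)).symm.finiteDimensional
  have hinj : ∀ a, IndepAt s A b d a ↔ Function.Injective (T a) := by
    intro a
    rw [injective_iff_map_eq_zero]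
    constructor
    · intro h v hv
      rw [hT] at hv
      let q : ι → ℚ[X] := fun i => if hi : i ∈ s then (v ⟨i, hi⟩ : ℚ[X]) else 0
      have hq : ∀ i : s, q i = v i := fun i => by simp [q]
      have := h q (fun i hi => by
        rw [hq ⟨i, hi⟩]
        exact mem_degreeLT.1 (v ⟨i, hi⟩).2) (by
        rw [← Finset.sum_coe_sort]
        simpa only [hq] using hv)
      funext i
      ext1
      rw [← hq i]
      exact this i i.2
    · intro h q hq hs i hi
      have := h (fun i => ⟨q i, mem_degreeLT.2 (hq i i.2)⟩) (by
        rw [hT, ← hs]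
        exact Finset.sum_coe_sort s fun i => q i * nodePoly a (A i) (b i))
      exact congrArg Subtype.val (congrFun this ⟨i, hi⟩)
  obtain ⟨D, hD, hD'⟩ := exists_eval_ne_zero_imp_injective T
    (fun v => ∑ i : s, (v i : ℚ[X]).map MvPolynomial.C * nodePoly MvPolynomial.X (A i) (b i))
    (fun a v => by
      rw [hT, Polynomial.map_sum]
      refine Finset.sum_congr rfl fun i _ => ?_
      rw [Polynomial.map_mul, map_nodePoly, Polynomial.map_map]
      have : (MvPolynomial.eval a).comp MvPolynomial.C = RingHom.id ℚ :=
        RingHom.ext fun x => MvPolynomial.eval_C x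
      simp [this])
    a₀ ((hinj a₀).1 h)
  exact ⟨D, fun h0 => hD (by simp [h0]), fun a ha => (hinj a).2 (hD' a ha)⟩

theorem IndepAt.of_erase [DecidableEq ι]
    {s : Finset ι} {A : ι → Finset σ} {b d : ι → ℕ} {a : σ → ℚ} {i : ι}
    (hd : d i = 0) (h : IndepAt (s.erase i) A b d a) : IndepAt s A b d a := by
  intro q hq hs
  have hz : i ∈ s → q i = 0 := fun hi => by
    have := hq i hi
    rw [hd] at this
    simpa using this
  have hs' : ∑ j ∈ s.erase i, q j * nodePoly a (A j) (b j) = 0 := by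
    rw [← hs]
    refine Finset.sum_subset (Finset.erase_subset _ _) fun j hj hj' => ?_
    obtain rfl : j = i := by
      by_contra hne
      exact hj' (Finset.mem_erase.2 ⟨hne, hj⟩)
    rw [hz hj, zero_mul]
  have := h q (fun j hj => hq j (Finset.mem_of_mem_erase hj)) hs'
  intro j hj
  by_cases hji : j = i
  · subst hji
    exact hz hj
  · exact this j (Finset.mem_erase.2 ⟨hji, hj⟩)

theorem IndepAt.of_sub_one {s : Finset ι} {A : ι → Finset σ} {b d : ι → ℕ} {a : σ → ℚ}
    (hb : ∀ i ∈ s, 1 ≤ b i) (h : IndepAt s A (fun i => b i - 1) d a) : IndepAt s A b d a := by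
  intro q hq hs
  refine h q hq ?_
  have : (X : ℚ[X]) * ∑ i ∈ s, q i * nodePoly a (A i) (b i - 1) = 0 := by
    rw [← hs, Finset.mul_sum]
    refine Finset.sum_congr rfl fun i hi => ?_
    obtain ⟨c, hc⟩ := Nat.exists_eq_add_of_le' (hb i hi)
    rw [hc, Nat.add_sub_cancel, nodePoly, nodePoly, pow_succ]
    ring
  exact (mul_eq_zero.1 this).resolve_left X_ne_zero

theorem IndepAt.of_update_zero [DecidableEq σ]
    {s : Finset ι} {A : ι → Finset σ} {b d : ι → ℕ} {a : σ → ℚ} {j : σ}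
    (h : IndepAt s (fun i => (A i).erase j) (fun i => b i + if j ∈ A i then 1 else 0) d a) :
    IndepAt s A b d (Function.update a j 0) := by
  intro q hq hs
  refine h q hq ?_
  rw [← hs]
  refine Finset.sum_congr rfl fun i _ => ?_
  congr 1
  have hprod : ∏ l ∈ (A i).erase j, (X + C (Function.update a j 0 l)) =
      ∏ l ∈ (A i).erase j, (X + C (a l)) :=
    Finset.prod_congr rfl fun l hl => by
      rw [Function.update_of_ne (Finset.ne_of_mem_erase hl)]
  by_cases hj : j ∈ A i
  · rw [nodePoly, nodePoly, ← Finset.mul_prod_erase _ _ hj, hprod]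
    simp [hj, pow_succ, mul_assoc]
  · rw [Finset.erase_eq_of_notMem hj] at hprod
    rw [nodePoly, nodePoly, hprod]
    simp [hj]

theorem IndepAt.of_update_succ [DecidableEq ι]
    {s : Finset ι} {A : ι → Finset σ} {b d : ι → ℕ} {a : σ → ℚ} {i : ι}
    (ha : ∀ j, a j ≠ 0) (hi : i ∈ s) (hbi : b i = 0) (hb : ∀ l ∈ s, l ≠ i → 1 ≤ b l)
    (h : IndepAt s A (Function.update b i 1) (Function.update d i (d i - 1)) a) :
    IndepAt s A b d a := by
  intro q hq hs
  have h0 : (q i).coeff 0 = 0 := by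
    have h1 := congrArg (Polynomial.eval 0) hs
    rw [eval_finsetSum, Finset.sum_eq_single_of_mem i hi] at h1
    · simpa [nodePoly, hbi, eval_prod, Finset.prod_eq_zero_iff, ha, coeff_zero_eq_eval_zero]
        using h1
    · intro l hl hne
      simp [nodePoly, Nat.one_le_iff_ne_zero.1 (hb l hl hne)]
  obtain ⟨r, hr⟩ := X_dvd_iff.2 h0
  have hdeg : r.degree < ((d i - 1 : ℕ) : WithBot ℕ) := by
    by_cases hr0 : r = 0
    · rw [hr0, degree_zero]
      exact WithBot.bot_lt_coe _
    · have h2 := hq i hi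
      rw [hr, degree_mul, degree_X, degree_eq_natDegree hr0] at h2
      rw [degree_eq_natDegree hr0]
      norm_cast at h2 ⊢
      omega
  have key := h (Function.update q i r) (fun l hl => by
      by_cases hli : l = i
      · subst hli
        simpa using hdeg
      · simpa [hli] using hq l hl) (by
      rw [← hs]
      refine Finset.sum_congr rfl fun l hl => ?_
      by_cases hli : l = i
      · subst hli
        simp [hr, nodePoly, hbi]
        ring
      · simp [hli])
  intro l hl
  have := key l hl
  by_cases hli : l = i
  · subst hli
    rw [Function.update_self] at this
    rw [hr, this, mul_zero]
  · rwa [Function.update_of_ne hli] at this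

theorem IndepAt.of_contract [DecidableEq ι] [DecidableEq σ] [Fintype σ]
    {s I : Finset ι} {A : ι → Finset σ} {b d : ι → ℕ} {a : σ → ℚ} {i₀ : ι}
    {k m : ℕ} (hcard : ∀ i ∈ s, (A i).card + b i + d i = k) (hI : I ⊆ s) (hi₀ : i₀ ∈ I)
    (hm : ∀ i ∈ I, m ≤ b i) (htight : ∑ i ∈ I, d i + (I.inf A).card + m = k)
    (h₁ : IndepAt I A b d a)
    (h₂ : IndepAt (insert i₀ (s \ I)) (Function.update A i₀ (I.inf A)) (Function.update b i₀ m)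
      (Function.update d i₀ (∑ i ∈ I, d i)) a) :
    IndepAt s A b d a := by
  intro q hq hs
  have hA : ∀ i ∈ I, I.inf A ⊆ A i := fun i hi => Finset.inf_le hi
  set Q := ∑ i ∈ I, q i * nodePoly a (A i \ I.inf A) (b i - m) with hQ
  have hfac : ∑ i ∈ I, q i * nodePoly a (A i) (b i) = Q * nodePoly a (I.inf A) m := by
    rw [hQ, Finset.sum_mul]
    refine Finset.sum_congr rfl fun i hi => ?_
    rw [← nodePoly_mul_nodePoly_sdiff a (hA i hi) (hm i hi)]
    ring
  have hQdeg : Q.degree < ((∑ i ∈ I, d i : ℕ) : WithBot ℕ) := by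
    rw [← mem_degreeLT]
    refine Submodule.sum_mem _ fun i hi => ?_
    rw [mem_degreeLT]
    by_cases hq0 : q i = 0
    · rw [hq0, zero_mul, degree_zero]
      exact WithBot.bot_lt_coe _
    · have h1 := hq i (hI hi)
      have h2 := hcard i (hI hi)
      have h3 := Finset.card_sdiff_add_card_eq_card (hA i hi)
      have h4 := hm i hi
      rw [degree_mul, degree_eq_natDegree (monic_nodePoly _ _ _).ne_zero, natDegree_nodePoly,
        degree_eq_natDegree hq0]
      rw [degree_eq_natDegree hq0] at h1
      norm_cast at h1 ⊢
      omega
  have hne : ∀ i ∈ s \ I, i ≠ i₀ := fun i hi h => (Finset.mem_sdiff.1 hi).2 (h ▸ hi₀)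
  have hnot : i₀ ∉ s \ I := fun h => hne i₀ h rfl
  have key := h₂ (Function.update q i₀ Q) (fun l hl => by
      rcases Finset.mem_insert.1 hl with rfl | hl
      · simpa using hQdeg
      · simpa [hne l hl] using hq l (Finset.mem_sdiff.1 hl).1) (by
      rw [Finset.sum_insert hnot, ← hs, ← Finset.sum_sdiff hI, hfac, add_comm]
      congr 1
      · refine Finset.sum_congr rfl fun l hl => ?_
        simp [hne l hl]
      · simp)
  have hQ0 : Q = 0 := by simpa using key i₀ (Finset.mem_insert_self _ _)
  have hIz := h₁ q (fun i hi => hq i (hI hi)) (by rw [hfac, hQ0, zero_mul])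
  intro i hi
  by_cases hiI : i ∈ I
  · exact hIz i hiI
  · have hi' := Finset.mem_sdiff.2 ⟨hi, hiI⟩
    simpa [hne i hi'] using key i (Finset.mem_insert_of_mem hi')

/-- The intersection condition under which the polynomials `x ^ e * nodePoly a (A i) (b i)`, for
`i ∈ s` and `e < d i`, all of degree less than `k`, are linearly independent for generic `a`. -/
structure Admissible [DecidableEq σ] [Fintype σ] (k : ℕ) (s : Finset ι) (A : ι → Finset σ)
    (b d : ι → ℕ) : Prop where
  card_add : ∀ i ∈ s, (A i).card + b i + d i = k
  le : ∀ I ⊆ s, I.Nonempty → ∀ m, (∀ i ∈ I, m ≤ b i) → ∑ i ∈ I, d i + (I.inf A).card + m ≤ k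

theorem Admissible.mono [DecidableEq σ] [Fintype σ]
    {k : ℕ} {s t : Finset ι} {A : ι → Finset σ} {b d : ι → ℕ}
    (h : Admissible k s A b d) (hts : t ⊆ s) : Admissible k t A b d :=
  ⟨fun i hi => h.card_add i (hts hi), fun I hI => h.le I (hI.trans hts)⟩

theorem Admissible.sub_one [DecidableEq σ] [Fintype σ]
    {k : ℕ} {s : Finset ι} {A : ι → Finset σ} {b d : ι → ℕ}
    (h : Admissible k s A b d) (hb : ∀ i ∈ s, 1 ≤ b i) :
    Admissible (k - 1) s A (fun i => b i - 1) d := by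
  refine ⟨fun i hi => ?_, fun I hI hne m hm => ?_⟩
  · have := h.card_add i hi
    have := hb i hi
    omega
  · have := h.le I hI hne (m + 1) fun i hi => by
      have := hm i hi
      have := hb i (hI hi)
      omega
    omega

theorem Admissible.contract [DecidableEq ι] [DecidableEq σ] [Fintype σ]
    {k m : ℕ} {s I : Finset ι} {A : ι → Finset σ} {b d : ι → ℕ} {i₀ : ι}
    (h : Admissible k s A b d) (hI : I ⊆ s) (hi₀ : i₀ ∈ I) (hm : ∀ i ∈ I, m ≤ b i)
    (htight : ∑ i ∈ I, d i + (I.inf A).card + m = k) :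
    Admissible k (insert i₀ (s \ I)) (Function.update A i₀ (I.inf A)) (Function.update b i₀ m)
      (Function.update d i₀ (∑ i ∈ I, d i)) := by
  have hne : ∀ i ∈ s \ I, i ≠ i₀ := fun i hi h => (Finset.mem_sdiff.1 hi).2 (h ▸ hi₀)
  refine ⟨fun i hi => ?_, fun J hJ hJne m' hm' => ?_⟩
  · rcases Finset.mem_insert.1 hi with rfl | hi
    · simp only [Function.update_self]
      omega
    · simpa [hne i hi] using h.card_add i (Finset.mem_sdiff.1 hi).1
  · have hJ' : J.erase i₀ ⊆ s \ I := Finset.subset_insert_iff.1 hJ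
    have hd : ∑ i ∈ J.erase i₀, Function.update d i₀ (∑ i ∈ I, d i) i = ∑ i ∈ J.erase i₀, d i :=
      Finset.sum_congr rfl fun i hi => by simp [Finset.ne_of_mem_erase hi]
    have hinf : (J.erase i₀).inf (Function.update A i₀ (I.inf A)) = (J.erase i₀).inf A :=
      Finset.inf_congr rfl fun i hi => by simp [Finset.ne_of_mem_erase hi]
    have hbJ : ∀ i ∈ J.erase i₀, m' ≤ b i := fun i hi => by
      simpa [Finset.ne_of_mem_erase hi] using hm' i (Finset.mem_of_mem_erase hi)
    by_cases hiJ : i₀ ∈ J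
    · have hmm : m' ≤ m := by simpa using hm' i₀ hiJ
      have hdisj : Disjoint (J.erase i₀) I :=
        Finset.disjoint_left.2 fun i hi => (Finset.mem_sdiff.1 (hJ' hi)).2
      have h1 := h.le (J.erase i₀ ∪ I)
        (Finset.union_subset (hJ'.trans Finset.sdiff_subset) hI) ⟨i₀, Finset.mem_union_right _ hi₀⟩
        m' fun i hi => (Finset.mem_union.1 hi).elim (hbJ i) fun hi => hmm.trans (hm i hi)
      rw [Finset.sum_union hdisj, Finset.inf_union] at h1
      rw [← Finset.insert_erase hiJ, Finset.sum_insert (Finset.notMem_erase _ _),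
        Finset.inf_insert, hd, hinf, Function.update_self, Function.update_self,
        inf_comm (I.inf A), add_comm (∑ i ∈ I, d i)]
      exact h1
    · rw [Finset.erase_eq_of_notMem hiJ] at hd hinf hbJ hJ'
      rw [hd, hinf]
      exact h.le J (hJ'.trans Finset.sdiff_subset) hJne m' hbJ

theorem Admissible.erase [DecidableEq σ] [Fintype σ]
    {k : ℕ} {s : Finset ι} {A : ι → Finset σ} {b d : ι → ℕ} {i₀ : ι} {j : σ}
    (h : Admissible k s A b d)
    (hslack : ∀ I ⊆ s, I ≠ s → 1 < I.card → ∀ m, (∀ i ∈ I, m ≤ b i) →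
      ∑ i ∈ I, d i + (I.inf A).card + m < k)
    (hi₀ : i₀ ∈ s) (hj : j ∉ A i₀) (hb : b i₀ = 0) :
    Admissible k s (fun i => (A i).erase j) (fun i => b i + if j ∈ A i then 1 else 0) d := by
  have hcard : ∀ i ∈ s,
      ((A i).erase j).card + (b i + if j ∈ A i then 1 else 0) + d i = k := fun i hi => by
    have h1 := h.card_add i hi
    split_ifs with hji
    · have := Finset.card_erase_add_one hji
      omega
    · rw [Finset.erase_eq_of_notMem hji]
      omega
  refine ⟨hcard, fun I hI hne m hm => ?_⟩
  have hle : (I.inf fun i => (A i).erase j).card ≤ (I.inf A).card :=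
    Finset.card_le_card (Finset.inf_mono_fun fun i _ => Finset.erase_subset _ _)
  by_cases h1 : I.card = 1
  · obtain ⟨i, rfl⟩ := Finset.card_eq_one.1 h1
    have h2 := hcard i (by simpa using hI)
    have h3 := hm i (by simp)
    simp only [Finset.sum_singleton, Finset.inf_singleton]
    omega
  by_cases hm0 : m = 0
  · subst hm0
    have := h.le I hI hne 0 fun i _ => Nat.zero_le _
    omega
  have hIs : I ≠ s := by
    rintro rfl
    have := hm i₀ hi₀
    simp only [hj, hb, if_false] at this
    omega
  have h2 := hslack I hI hIs (by have := hne.card_pos; omega) (m - 1) fun i hi => by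
    have := hm i hi
    split_ifs at this <;> omega
  omega

theorem Admissible.update_succ [DecidableEq ι] [DecidableEq σ] [Fintype σ]
    {k : ℕ} {s : Finset ι} {A : ι → Finset σ} {b d : ι → ℕ} {i : ι}
    (h : Admissible k s A b d) (hb : b i = 0) (hd : 1 ≤ d i) :
    Admissible k s A (Function.update b i 1) (Function.update d i (d i - 1)) := by
  refine ⟨fun l hl => ?_, fun I hI hne m hm => ?_⟩
  · have := h.card_add l hl
    by_cases hli : l = i
    · subst hli
      simp only [Function.update_self]
      omega
    · simpa [hli] using this
  · by_cases hiI : i ∈ I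
    · have h1 := h.le I hI hne 0 fun _ _ => Nat.zero_le _
      have h2 : m ≤ 1 := by simpa using hm i hiI
      rw [Finset.sum_update_of_mem hiI]
      rw [← Finset.add_sum_erase _ _ hiI, Finset.erase_eq] at h1
      omega
    · rw [Finset.sum_update_of_notMem hiI]
      exact h.le I hI hne m fun l hl => by
        simpa [show l ≠ i from fun h => hiI (h ▸ hl)] using hm l hl

theorem exists_eval_ne_zero {D : MvPolynomial σ ℚ} (hD : D ≠ 0) :
    ∃ a, MvPolynomial.eval a D ≠ 0 := by
  by_contra! h
  exact hD (MvPolynomial.funext fun a => by simpa using h a)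

theorem Admissible.exists_indepAt [DecidableEq ι] [DecidableEq σ] [Fintype σ]
    {k : ℕ} {s : Finset ι} {A : ι → Finset σ} {b d : ι → ℕ}
    (h : Admissible k s A b d) : ∃ a, IndepAt s A b d a := by
  induction hN : k + s.card + ∑ i ∈ s, (A i).card + ∑ i ∈ s, d i using Nat.strong_induction_on
    generalizing k s A b d with
  | _ N ih =>
  subst hN
  rcases s.eq_empty_or_nonempty with rfl | hs
  · exact ⟨0, fun q _ _ i hi => absurd hi (Finset.notMem_empty i)⟩
  by_cases hd : ∃ i ∈ s, d i = 0
  · obtain ⟨i, hi, hdi⟩ := hd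
    obtain ⟨a, ha⟩ := ih _ (by
      have h1 := Finset.card_erase_add_one hi
      have h2 := Finset.add_sum_erase s (fun i => (A i).card) hi
      have h3 := Finset.add_sum_erase s d hi
      omega) (h.mono (s.erase_subset i)) rfl
    exact ⟨a, ha.of_erase hdi⟩
  by_cases htight : ∃ I ⊆ s, I ≠ s ∧ 1 < I.card ∧ ∃ m, (∀ i ∈ I, m ≤ b i) ∧
      k ≤ ∑ i ∈ I, d i + (I.inf A).card + m
  · obtain ⟨I, hI, hIs, hI1, m, hm, hk⟩ := htight
    obtain ⟨i₀, hi₀⟩ : I.Nonempty := Finset.card_pos.1 (by omega)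
    have hk' := (h.le I hI ⟨i₀, hi₀⟩ m hm).antisymm hk
    have hlt := Finset.card_lt_card (hI.ssubset_of_ne hIs)
    have hsA := Finset.sum_sdiff (f := fun i => (A i).card) hI
    have hsd := Finset.sum_sdiff (f := d) hI
    have hsc := Finset.card_sdiff_add_card_eq_card hI
    obtain ⟨a₁, ha₁⟩ := ih _ (by omega) (h.mono hI) rfl
    have hne : ∀ i ∈ s \ I, i ≠ i₀ := fun i hi h => (Finset.mem_sdiff.1 hi).2 (h ▸ hi₀)
    have hnot : i₀ ∉ s \ I := fun h => hne i₀ h rfl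
    obtain ⟨a₂, ha₂⟩ := ih _ (by
      have h1 : (I.inf A).card ≤ ∑ i ∈ I, (A i).card :=
        (Finset.card_le_card (Finset.inf_le hi₀)).trans
          (Finset.single_le_sum (f := fun i => (A i).card) (fun _ _ => Nat.zero_le _) hi₀)
      rw [Finset.card_insert_of_notMem hnot, Finset.sum_insert hnot, Finset.sum_insert hnot,
        Finset.sum_congr rfl fun i hi => congrArg Finset.card
          (Function.update_of_ne (hne i hi) (I.inf A) A),
        show ∑ i ∈ s \ I, Function.update d i₀ (∑ i ∈ I, d i) i = ∑ i ∈ s \ I, d i from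
          Finset.sum_congr rfl fun i hi => Function.update_of_ne (hne i hi) _ d,
        Function.update_self, Function.update_self]
      omega) (h.contract hI hi₀ hm hk') rfl
    obtain ⟨D₁, hD₁, h₁⟩ := ha₁.exists_eval_ne_zero
    obtain ⟨D₂, hD₂, h₂⟩ := ha₂.exists_eval_ne_zero
    obtain ⟨a, ha⟩ := exists_eval_ne_zero (mul_ne_zero hD₁ hD₂)
    rw [map_mul] at ha
    exact ⟨a, .of_contract h.card_add hI hi₀ hm hk' (h₁ a (left_ne_zero_of_mul ha))
      (h₂ a (right_ne_zero_of_mul ha))⟩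
  push Not at hd htight
  by_cases hb : ∀ i ∈ s, 1 ≤ b i
  · obtain ⟨i, hi⟩ := hs
    obtain ⟨a, ha⟩ := ih _ (by
      have := h.card_add i hi
      have := hb i hi
      omega) (h.sub_one hb) rfl
    exact ⟨a, ha.of_sub_one hb⟩
  by_cases hj : ∃ j, (∃ i ∈ s, j ∈ A i) ∧ ∃ i ∈ s, j ∉ A i ∧ b i = 0
  · obtain ⟨j, ⟨i, hi, hji⟩, i₀, hi₀, hji₀, hbi₀⟩ := hj
    obtain ⟨a, ha⟩ := ih _ (by
      have : ∑ i ∈ s, ((A i).erase j).card < ∑ i ∈ s, (A i).card :=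
        Finset.sum_lt_sum (fun i _ => Finset.card_le_card (Finset.erase_subset _ _))
          ⟨i, hi, Finset.card_erase_lt_of_mem hji⟩
      omega) (h.erase htight hi₀ hji₀ hbi₀) rfl
    exact ⟨_, ha.of_update_zero⟩
  push Not at hb hj
  obtain ⟨i, hi, hbi⟩ := hb
  replace hbi : b i = 0 := by omega
  have huniq : ∀ l ∈ s, l ≠ i → 1 ≤ b l := by
    intro l hl hli
    by_contra hbl
    replace hbl : b l = 0 := by omega
    have hA : A l = A i := by
      ext j
      refine ⟨fun hjl => ?_, fun hji => ?_⟩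
      · by_contra hc
        exact hj j ⟨l, hl, hjl⟩ i hi hc hbi
      · by_contra hc
        exact hj j ⟨i, hi, hji⟩ l hl hc hbl
    have h1 := h.le {l, i} (by simp [Finset.insert_subset_iff, hl, hi]) (by simp) 0 (by simp)
    rw [Finset.sum_pair hli, Finset.inf_insert, Finset.inf_singleton, hA, inf_idem] at h1
    have h2 := h.card_add i hi
    have h3 := hd l hl
    omega
  have hdi : 1 ≤ d i := Nat.one_le_iff_ne_zero.2 (hd i hi)
  obtain ⟨a₁, ha₁⟩ := ih _ (by
    have h1 := Finset.add_sum_erase s d hi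
    rw [Finset.sum_update_of_mem hi, ← Finset.erase_eq]
    omega) (h.update_succ hbi hdi) rfl
  obtain ⟨D, hD, h₁⟩ := ha₁.exists_eval_ne_zero
  obtain ⟨a, ha⟩ := exists_eval_ne_zero
    (mul_ne_zero hD (Finset.prod_ne_zero_iff.2 fun (j : σ) (_ : j ∈ Finset.univ) =>
      MvPolynomial.X_ne_zero (R := ℚ) j))
  rw [map_mul, map_prod] at ha
  refine ⟨a, .of_update_succ (fun j => ?_) hi hbi huniq (h₁ a (left_ne_zero_of_mul ha))⟩
  simpa using Finset.prod_ne_zero_iff.1 (right_ne_zero_of_mul ha) j (Finset.mem_univ j)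

end SupportConstrained

theorem det_coeff_ne_zero_iff_linearIndependent {F : Type*} [Field F] {k : ℕ} (p : Fin k → F[X])
    (hp : ∀ i, (p i).natDegree < k) :
    (Matrix.of fun i c : Fin k => (p i).coeff (k - 1 - (c : ℕ))).det ≠ 0 ↔
      LinearIndependent F p := by
  have hvec : ∀ g : Fin k → F, Matrix.vecMul g
      (Matrix.of fun i c : Fin k => (p i).coeff (k - 1 - (c : ℕ))) = 0 ↔ ∑ i, g i • p i = 0 := by
    intro g
    have hentry : ∀ c : Fin k, Matrix.vecMul g
        (Matrix.of fun i c : Fin k => (p i).coeff (k - 1 - (c : ℕ))) c =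
        (∑ i, g i • p i).coeff (k - 1 - (c : ℕ)) := fun c => by
      simp [Matrix.vecMul, dotProduct]
    constructor
    · intro h
      ext e
      by_cases he : e < k
      · have h1 := congrFun h ⟨k - 1 - e, by omega⟩
        rw [hentry] at h1
        simpa [show k - 1 - (k - 1 - e) = e by omega] using h1
      · rw [finsetSum_coeff, coeff_zero]
        refine Finset.sum_eq_zero fun i _ => ?_
        rw [coeff_smul, coeff_eq_zero_of_natDegree_lt ((hp i).trans_le (by omega)), smul_zero]
    · intro h
      funext c
      rw [hentry, h]
      simp
  rw [not_iff_comm, Fintype.not_linearIndependent_iff, ← Matrix.exists_vecMul_eq_zero_iff]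
  simp only [hvec, Function.ne_iff, Pi.zero_apply, and_comm]

theorem card_inf_add_card_le_of_linearIndependent {F ι σ : Type*} [Field F] [Fintype σ]
    [DecidableEq σ] {k : ℕ} (a : σ → F) (S : ι → Finset σ) (hS : ∀ i, (S i).card < k)
    (h : LinearIndependent F fun i => ∏ j ∈ S i, (X + C (a j))) (Ω : Finset ι)
    (hΩ : Ω.Nonempty) : (Ω.inf S).card + Ω.card ≤ k := by
  let r : Ω → degreeLT F (k - (Ω.inf S).card) := fun i =>
    ⟨nodePoly a (S i \ Ω.inf S) 0, by
      rw [mem_degreeLT, degree_eq_natDegree (monic_nodePoly _ _ _).ne_zero, natDegree_nodePoly]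
      have := Finset.card_sdiff_add_card_eq_card (s := Ω.inf S) (t := S i) (Finset.inf_le i.2)
      have := hS i
      norm_cast
      omega⟩
  have hr : LinearIndependent F r := by
    let f := LinearMap.mulLeft F (nodePoly a (Ω.inf S) 0) ∘ₗ
      (degreeLT F (k - (Ω.inf S).card)).subtype
    have hf : f ∘ r = (fun i => ∏ j ∈ S i, (X + C (a j))) ∘ Subtype.val := by
      funext i
      have := nodePoly_mul_nodePoly_sdiff a (A := Ω.inf S) (B := S i) (b := 0) (c := 0)
        (Finset.inf_le i.2) le_rfl
      simpa [f, r, nodePoly] using this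
    refine LinearIndependent.of_comp f ?_
    rw [hf]
    exact h.comp _ Subtype.val_injective
  have : FiniteDimensional F (degreeLT F (k - (Ω.inf S).card)) :=
    (degreeLTEquiv F _).symm.finiteDimensional
  have h1 := hr.fintype_card_le_finrank
  rw [(degreeLTEquiv F _).finrank_eq, Module.finrank_fin_fun, Fintype.card_coe] at h1
  obtain ⟨i, hi⟩ := hΩ
  have h2 := Finset.card_le_card (Finset.inf_le (f := S) hi)
  have h3 := hS i
  omega

/-- **Corollary 1.** For `S_1,…,S_k ⊆ [n]` with `|S_i| = k-1`, the `k × k` matrix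
whose `(i,c)` entry (with `c` 0-based here, corresponding to the 1-based column
`c+1`) is the coefficient of `x^(k-1-c)` in `∏_{j∈S_i}(x+α_j)`, i.e. the `c`-th
elementary symmetric polynomial of `{α_j : j ∈ S_i}`, has nonzero determinant iff
for every nonempty `Ω ⊆ [k]`, `|⋂_{i∈Ω} S_i| ≤ k - |Ω|`. -/
theorem stmt_7 {k n : ℕ} (hk : 1 ≤ k)
    (S : Fin k → Finset (Fin n)) (hcard : ∀ i, (S i).card = k - 1) :
    (Matrix.of fun i c : Fin k =>
        (∏ j ∈ S i, (X + C (alf j))).coeff (k - 1 - (c : ℕ))).det ≠ 0 ↔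
      ∀ Ω : Finset (Fin k), Ω.Nonempty → (Ω.inf S).card + Ω.card ≤ k := by
  have hprod : ∀ {R : Type} [CommRing R] (a : Fin n → R) (i : Fin k),
      ∏ j ∈ S i, (X + C (a j)) = nodePoly a (S i) 0 := fun a i => by simp [nodePoly]
  have hdeg : ∀ {F : Type} [Field F] (a : Fin n → F) (i : Fin k),
      (∏ j ∈ S i, (X + C (a j))).natDegree < k := fun a i => by
    rw [hprod, natDegree_nodePoly, hcard]
    omega
  constructor
  · intro hdet Ω hΩ
    rw [det_coeff_ne_zero_iff_linearIndependent _ (hdeg _)] at hdet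
    exact card_inf_add_card_le_of_linearIndependent alf S (fun i => by rw [hcard]; omega) hdet Ω hΩ
  · intro h
    have hadm : Admissible k Finset.univ S (fun _ => 0) (fun _ => 1) := by
      refine ⟨fun i _ => by rw [hcard]; omega, fun I _ hne m hm => ?_⟩
      obtain ⟨i, hi⟩ := hne
      have h1 := h I ⟨i, hi⟩
      have h2 := hm i hi
      simp only [Finset.sum_const, smul_eq_mul, mul_one]
      omega
    obtain ⟨a, ha⟩ := hadm.exists_indepAt
    have hlin : LinearIndependent ℚ fun i => ∏ j ∈ S i, (X + C (a j)) := by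
      rw [Fintype.linearIndependent_iff]
      intro g hg i
      have := ha (fun i => C (g i)) (fun i _ => degree_C_lt) (by
        simpa only [← hprod, ← smul_eq_C_mul] using hg) i (Finset.mem_univ i)
      exact C_eq_zero.1 this
    rw [← det_coeff_ne_zero_iff_linearIndependent _ (hdeg _)] at hlin
    let M : Matrix (Fin k) (Fin k) (MvPolynomial (Fin n) ℚ) :=
      Matrix.of fun i c => (nodePoly MvPolynomial.X (S i) 0).coeff (k - 1 - (c : ℕ))
    have hM : ∀ {R : Type} [CommRing R] (f : MvPolynomial (Fin n) ℚ →+* R),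
        f M.det = (Matrix.of fun i c : Fin k =>
          (∏ j ∈ S i, (X + C (f (MvPolynomial.X j)))).coeff (k - 1 - (c : ℕ))).det := fun f => by
      rw [RingHom.map_det]
      congr 1
      ext i c
      simp only [M, RingHom.mapMatrix_apply, Matrix.map_apply, Matrix.of_apply]
      rw [hprod (fun j => f (MvPolynomial.X j)), ← map_nodePoly, coeff_map]
    have hM0 : M.det ≠ 0 := fun h0 => hlin (by
      have := hM (MvPolynomial.eval a)
      simp only [h0, map_zero, MvPolynomial.eval_X] at this
      exact this.symm)
    refine ne_of_eq_of_ne (hM (algebraMap (MvPolynomial (Fin n) ℚ) (Kn n))).symm ?_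
    exact (map_ne_zero_iff _ (IsFractionRing.injective _ _)).2 hM0
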